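/- Let c > 0 be a real number and let f(n) = ⌈c·n^{3/2}⌉. Then the set of achievable burning densities is P(G(f)) = [0, (1+√6·c)^{-2}]. -/

import Mathlib

open Filter Asymptotics

/-- Membership in the grid `[-f n, f n]^2 ⊆ ℤ × ℤ`. -/
def inGrid (f : ℕ → ℕ) (n : ℕ) (p : ℤ × ℤ) : Prop :=
  |p.1| ≤ (f n : ℤ) ∧ |p.2| ≤ (f n : ℤ)

instance (f : ℕ → ℕ) (n : ℕ) : DecidablePred (inGrid f n) := fun _ => by
  unfold inGrid; infer_instance

/-- The four lattice neighbours (at `L¹`-distance one) of a point. -/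
def nbrs (p : ℤ × ℤ) : Finset (ℤ × ℤ) :=
  {(p.1 + 1, p.2), (p.1 - 1, p.2), (p.1, p.2 + 1), (p.1, p.2 - 1)}

/-- An activator sequence: whenever `V n ≠ ∅` (for `n ≥ 1`), the activated vertex
lies in the grid at time `n`. -/
def IsActivator (f : ℕ → ℕ) (V : ℕ → Option (ℤ × ℤ)) : Prop :=
  ∀ n, 1 ≤ n → ∀ p, V n = some p → inGrid f n p

/-- The burning process: `B 0 = ∅`, and `B n` is obtained from `B (n-1)` by adding all
vertices of the grid at time `n` adjacent to a vertex of `B (n-1)`, and then adding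
the activator `V n` if it is not `∅`. -/
def burnSet (f : ℕ → ℕ) (V : ℕ → Option (ℤ × ℤ)) : ℕ → Finset (ℤ × ℤ)
  | 0 => ∅
  | n + 1 =>
    let B := burnSet f V n
    let spread := B ∪ (B.biUnion nbrs).filter (inGrid f (n + 1))
    match V (n + 1) with
    | none => spread
    | some v => insert v spread

/-- The proportion `|B n| / |V(G n)|` of burning vertices at time `n`. -/
noncomputable def densitySeq (f : ℕ → ℕ) (V : ℕ → Option (ℤ × ℤ)) (n : ℕ) : ℝ :=
  ((burnSet f V n).card : ℝ) / (2 * (f n : ℝ) + 1) ^ 2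

/-- The lower burning density `δ̲(G(f), V)`. -/
noncomputable def lowerDensity (f : ℕ → ℕ) (V : ℕ → Option (ℤ × ℤ)) : ℝ :=
  liminf (densitySeq f V) atTop

/-- The upper burning density `δ̄(G(f), V)`. -/
noncomputable def upperDensity (f : ℕ → ℕ) (V : ℕ → Option (ℤ × ℤ)) : ℝ :=
  limsup (densitySeq f V) atTop

/-- The burning density of `V` in `G(f)` exists and equals `ρ`. -/
def HasBurningDensity (f : ℕ → ℕ) (V : ℕ → Option (ℤ × ℤ)) (ρ : ℝ) : Prop :=
  Tendsto (densitySeq f V) atTop (nhds ρ)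

/-- `P(G(f))`: the set of `ρ ∈ [0,1]` achievable as the burning density of some
non-empty activator sequence. -/
def densSet (f : ℕ → ℕ) : Set ℝ :=
  {ρ | ρ ∈ Set.Icc (0 : ℝ) 1 ∧
    ∃ V : ℕ → Option (ℤ × ℤ), IsActivator f V ∧ (∃ t, 1 ≤ t ∧ V t ≠ none) ∧
      HasBurningDensity f V ρ}

/-- The controlled growth requirement. -/
def ControlledGrowth (f : ℕ → ℕ) : Prop :=
  (∀ᶠ n in atTop, f n < f (n + 1)) ∧
  (∀ ε : ℕ → ℕ, (fun n => (ε n : ℝ)) =o[atTop] (fun n => (n : ℝ)) →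
    Tendsto (fun n => (f (n + ε n) : ℝ) / (f n : ℝ)) atTop (nhds 1)) ∧
  (∀ c : ℝ, 0 < c → ∃ d : ℝ, 0 < d ∧
    ∀ᶠ n in atTop, (1 + d) * (f n : ℝ) ≤ (f (n + ⌈c * n⌉₊) : ℝ))


/-- The ball of radius `r` around `v` in the `L¹` metric of `ℤ × ℤ`. -/
noncomputable def l1Ball (v : ℤ × ℤ) (r : ℕ) : Finset (ℤ × ℤ) :=
  (Finset.Icc (v.1 - r) (v.1 + r) ×ˢ Finset.Icc (v.2 - r) (v.2 + r)).filter
    fun p => |p.1 - v.1| + |p.2 - v.2| ≤ r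

theorem mem_l1Ball {v p : ℤ × ℤ} {r : ℕ} :
    p ∈ l1Ball v r ↔ |p.1 - v.1| + |p.2 - v.2| ≤ r := by
  simp only [l1Ball, Finset.mem_filter, Finset.mem_product, Finset.mem_Icc]
  grind

theorem l1Ball_mono {v : ℤ × ℤ} {r s : ℕ} (h : r ≤ s) : l1Ball v r ⊆ l1Ball v s := by
  intro p hp
  rw [mem_l1Ball] at *
  omega

/-- The two parity classes of an `L¹` ball are rotated squares of sides `r + 1` and `r`. -/
theorem card_l1Ball (v : ℤ × ℤ) (r : ℕ) : (l1Ball v r).card = 2 * r ^ 2 + 2 * r + 1 := by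
  have key : l1Ball v r =
      (Finset.range (r + 1) ×ˢ Finset.range (r + 1)).image
        (fun q : ℕ × ℕ => (v.1 + q.1 + q.2 - r, v.2 + q.1 - q.2)) ∪
      (Finset.range r ×ˢ Finset.range r).image
        (fun q : ℕ × ℕ => (v.1 + q.1 + q.2 - r + 1, v.2 + q.1 - q.2)) := by
    ext ⟨x, y⟩
    simp only [mem_l1Ball, Finset.mem_union, Finset.mem_image, Finset.mem_product,
      Finset.mem_range, Prod.exists, Prod.mk.injEq]
    constructor
    · intro h
      have h1 : |x - v.1 + (y - v.2)| ≤ r := by grind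
      have h2 : |x - v.1 - (y - v.2)| ≤ r := by grind
      rw [abs_le] at h1 h2
      rcases Int.emod_two_eq_zero_or_one (x - v.1 + (y - v.2) + r) with h0 | h0
      · left
        exact ⟨((x - v.1 + (y - v.2) + r) / 2).toNat, ((x - v.1 - (y - v.2) + r) / 2).toNat,
          by omega, by omega, by omega⟩
      · right
        exact ⟨((x - v.1 + (y - v.2) + r) / 2).toNat, ((x - v.1 - (y - v.2) + r) / 2).toNat,
          by omega, by omega, by omega⟩
    · rintro (⟨i, j, ⟨hi, hj⟩, rfl, rfl⟩ | ⟨i, j, ⟨hi, hj⟩, rfl, rfl⟩) <;> grind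
  rw [key, Finset.card_union_of_disjoint, Finset.card_image_of_injective,
    Finset.card_image_of_injective]
  · simp only [Finset.card_product, Finset.card_range]
    ring
  · rintro ⟨a, b⟩ ⟨a', b'⟩ h
    simp only [Prod.mk.injEq] at h ⊢
    omega
  · rintro ⟨a, b⟩ ⟨a', b'⟩ h
    simp only [Prod.mk.injEq] at h ⊢
    omega
  · rw [Finset.disjoint_left]
    simp only [Finset.mem_image, Prod.exists, Finset.mem_product, Finset.mem_range]
    rintro p ⟨a, b, -, rfl⟩ ⟨a', b', -, h⟩
    simp only [Prod.mk.injEq] at h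
    omega

theorem mem_burnSet_succ {f : ℕ → ℕ} {V : ℕ → Option (ℤ × ℤ)} {n : ℕ} {p : ℤ × ℤ} :
    p ∈ burnSet f V (n + 1) ↔ V (n + 1) = some p ∨ p ∈ burnSet f V n ∨
      (∃ q ∈ burnSet f V n, p ∈ nbrs q) ∧ inGrid f (n + 1) p := by
  rw [burnSet]
  cases h : V (n + 1) with
  | none => simp
  | some v =>
    simp only [Finset.mem_insert, Finset.mem_union, Finset.mem_filter, Finset.mem_biUnion,
      Option.some.injEq]
    rw [eq_comm (a := p)]

theorem exists_activator_of_mem_burnSet {f : ℕ → ℕ} {V : ℕ → Option (ℤ × ℤ)} {n : ℕ}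
    {p : ℤ × ℤ} (hp : p ∈ burnSet f V n) :
    ∃ t v, 1 ≤ t ∧ t ≤ n ∧ V t = some v ∧ p ∈ l1Ball v (n - t) := by
  induction n generalizing p with
  | zero => simp [burnSet] at hp
  | succ n ih =>
    rcases mem_burnSet_succ.1 hp with h | h | ⟨⟨q, hq, hpq⟩, -⟩
    · exact ⟨n + 1, p, by omega, le_rfl, h, by simp [mem_l1Ball]⟩
    · obtain ⟨t, v, h1, h2, h3, h4⟩ := ih h
      exact ⟨t, v, h1, by omega, h3, l1Ball_mono (by omega) h4⟩
    · obtain ⟨t, v, h1, h2, h3, h4⟩ := ih hq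
      refine ⟨t, v, h1, by omega, h3, ?_⟩
      rw [mem_l1Ball] at *
      have : ((n + 1 - t : ℕ) : ℤ) = (n - t : ℕ) + 1 := by omega
      rw [this]
      simp only [nbrs, Finset.mem_insert, Finset.mem_singleton] at hpq
      rcases hpq with rfl | rfl | rfl | rfl <;> grind

theorem exists_mem_nbrs_l1Ball {v p : ℤ × ℤ} {s : ℕ} (hp : p ∈ l1Ball v (s + 1)) :
    p ∈ l1Ball v s ∨ ∃ q ∈ l1Ball v s, p ∈ nbrs q := by
  obtain ⟨x, y⟩ := p
  obtain ⟨a, b⟩ := v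
  simp only [mem_l1Ball, nbrs, Finset.mem_insert, Finset.mem_singleton, Prod.mk.injEq,
    Prod.exists] at *
  push_cast at hp
  rcases lt_trichotomy x a with h | h | h
  · exact .inr ⟨x + 1, y, by grind, by grind⟩
  · rcases lt_trichotomy y b with h' | h' | h'
    · exact .inr ⟨x, y + 1, by grind, by grind⟩
    · left; grind
    · exact .inr ⟨x, y - 1, by grind, by grind⟩
  · exact .inr ⟨x - 1, y, by grind, by grind⟩

theorem l1Ball_subset_burnSet {f : ℕ → ℕ} {V : ℕ → Option (ℤ × ℤ)} {t : ℕ} {v : ℤ × ℤ}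
    (ht : 1 ≤ t) (hv : V t = some v)
    (hgrid : ∀ s, ∀ p ∈ l1Ball v s, inGrid f (t + s) p) (s : ℕ) :
    l1Ball v s ⊆ burnSet f V (t + s) := by
  induction s with
  | zero =>
    intro p hp
    have : p = v := by
      rw [mem_l1Ball] at hp
      push_cast at hp
      ext <;> grind
    obtain ⟨t, rfl⟩ := Nat.exists_eq_add_of_le' ht
    rw [add_zero, mem_burnSet_succ, this]
    exact .inl hv
  | succ s ih =>
    intro p hp
    rw [← add_assoc, mem_burnSet_succ]
    rcases exists_mem_nbrs_l1Ball hp with h | ⟨q, hq, hpq⟩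
    · exact .inr (.inl (ih h))
    · exact .inr (.inr ⟨⟨q, ih hq, hpq⟩, hgrid _ _ hp⟩)

theorem sum_range_card_l1Ball (m : ℕ) :
    ∑ j ∈ Finset.range m, (2 * (j : ℝ) ^ 2 + 2 * j + 1) = (2 * (m : ℝ) ^ 3 + m) / 3 := by
  induction m with
  | zero => simp
  | succ m ih =>
    rw [Finset.sum_range_succ, ih]
    push_cast
    ring

/-- Balls activated up to time `t` stay close to the grid `[-F t, F t]²`; the later ones are
counted separately. -/
theorem card_burnSet_le {f F : ℕ → ℕ} {V : ℕ → Option (ℤ × ℤ)} (hF : Monotone F)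
    (hV : IsActivator F V) {t n : ℕ} (htn : t ≤ n) :
    ((burnSet f V n).card : ℝ) ≤
      (2 * ((F t : ℝ) + n) + 1) ^ 2 + (2 * ((n : ℝ) - t) ^ 3 + (n - t)) / 3 := by
  set M : ℕ := F t + n with hM
  set b : ℕ → Finset (ℤ × ℤ) := fun s => (V s).elim ∅ fun v => l1Ball v (n - s) with hb
  have hsub : burnSet f V n ⊆
      (Finset.Icc (-(M : ℤ)) M ×ˢ Finset.Icc (-(M : ℤ)) M) ∪ (Finset.Ioc t n).biUnion b := by
    intro p hp
    obtain ⟨s, v, h1, h2, h3, h4⟩ := exists_activator_of_mem_burnSet hp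
    rw [Finset.mem_union]
    rcases le_or_gt s t with h | h
    · left
      have hg := hV s h1 v h3
      have := hF h
      simp only [inGrid] at hg
      rw [mem_l1Ball] at h4
      simp only [Finset.mem_product, Finset.mem_Icc]
      grind
    · right
      rw [Finset.mem_biUnion]
      exact ⟨s, Finset.mem_Ioc.2 ⟨h, h2⟩, by simpa [hb, h3] using h4⟩
  have hbs : ∀ s ∈ Finset.Ioc t n, ((b s).card : ℝ) ≤
      2 * ((n - s : ℕ) : ℝ) ^ 2 + 2 * ((n - s : ℕ) : ℝ) + 1 := by
    intro s _
    cases h : V s with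
    | none => simp only [hb, h, Option.elim, Finset.card_empty, Nat.cast_zero]; positivity
    | some v =>
      simp only [hb, h, Option.elim, card_l1Ball]
      push_cast
      exact le_rfl
  have hsum : ∑ s ∈ Finset.Ioc t n, (2 * ((n - s : ℕ) : ℝ) ^ 2 + 2 * ((n - s : ℕ) : ℝ) + 1) =
      (2 * ((n - t : ℕ) : ℝ) ^ 3 + (n - t : ℕ)) / 3 := by
    rw [← sum_range_card_l1Ball]
    refine Finset.sum_nbij' (fun s => n - s) (fun j => n - j) ?_ ?_ ?_ ?_
      (fun _ _ => rfl) <;> simp only [Finset.mem_Ioc, Finset.mem_range] <;> intros <;> omega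
  have hcard := (Finset.card_le_card hsub).trans (Finset.card_union_le _ _)
  have hcard' : ((burnSet f V n).card : ℝ) ≤
      ((2 * M + 1) ^ 2 : ℕ) + ∑ s ∈ Finset.Ioc t n, ((b s).card : ℝ) := by
    have hsq : (Finset.Icc (-(M : ℤ)) M ×ˢ Finset.Icc (-(M : ℤ)) M).card = (2 * M + 1) ^ 2 := by
      rw [Finset.card_product, Int.card_Icc, sq]
      congr <;> omega
    have := hcard.trans (add_le_add_right (Finset.card_biUnion_le) _)
    rw [hsq] at this
    exact_mod_cast this
  refine hcard'.trans ?_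
  refine (add_le_add_right ((Finset.sum_le_sum hbs).trans_eq hsum) _).trans_eq ?_
  rw [Nat.cast_sub htn, hM]
  push_cast
  ring

theorem eq_of_checkerboard_dist_lt {p q b p' q' b' : ℤ} (hb : 0 ≤ b ∧ b ≤ 1)
    (hb' : 0 ≤ b' ∧ b' ≤ 1)
    (h : |(2 * p + b) - (2 * p' + b')| + |(2 * q + b) - (2 * q' + b')| < 2) :
    p = p' ∧ q = q' ∧ b = b' := by
  have h1 := (abs_add_le ((2 * p + b) - (2 * p' + b')) ((2 * q + b) - (2 * q' + b'))).trans_lt h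
  have h2 := (abs_sub ((2 * p + b) - (2 * p' + b')) ((2 * q + b) - (2 * q' + b'))).trans_lt h
  rw [abs_lt] at h1 h2
  omega

/-- Points of the checkerboard lattice of scale `R` in a square annulus, as centres of disjoint
`L¹` balls of radius `R - 1`. -/
theorem exists_disjoint_l1Balls {R P Q N : ℕ} (hR : 1 ≤ R)
    (hN : N + 2 * (2 * Q + 1) ^ 2 ≤ 2 * (2 * P + 1) ^ 2) :
    ∃ c : ℕ → ℤ × ℤ,
      (∀ i < N, (R * (2 * Q + 1) : ℤ) ≤ max |(c i).1| |(c i).2| ∧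
        max |(c i).1| |(c i).2| ≤ (R * (2 * P + 1) : ℤ)) ∧
      ∀ i < N, ∀ j < N, i ≠ j → Disjoint (l1Ball (c i) (R - 1)) (l1Ball (c j) (R - 1)) := by
  let box : ℕ → Finset (ℤ × ℤ) := fun M =>
    Finset.Icc (-(M : ℤ)) M ×ˢ Finset.Icc (-(M : ℤ)) M
  have hbox : ∀ M, (box M).card = (2 * M + 1) ^ 2 := by
    intro M
    rw [Finset.card_product, Int.card_Icc, sq]
    congr <;> omega
  let S : Finset ((ℤ × ℤ) × ℤ) := (box P \ box Q) ×ˢ Finset.Icc 0 1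
  have hS : Fintype.card (Fin N) ≤ Fintype.card S := by
    rw [Fintype.card_fin, Fintype.card_coe, Finset.card_product, Int.card_Icc]
    have h := Finset.le_card_sdiff (box Q) (box P)
    rw [hbox, hbox] at h
    simp only [show ((1 : ℤ) + 1 - 0).toNat = 2 from rfl]
    omega
  obtain ⟨e⟩ := Function.Embedding.nonempty_of_card_le hS
  let d : ℕ → (ℤ × ℤ) × ℤ := fun i => if h : i < N then (e ⟨i, h⟩ : (ℤ × ℤ) × ℤ) else 0
  have hd : ∀ i < N, d i ∈ S := by
    intro i hi
    simp only [d, hi, dif_pos]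
    exact (e ⟨i, hi⟩).2
  have hinj : ∀ i < N, ∀ j < N, d i = d j → i = j := by
    intro i hi j hj h
    simp only [d, hi, hj, dif_pos] at h
    simpa using e.injective (Subtype.ext h)
  have hR' : (1 : ℤ) ≤ R := by exact_mod_cast hR
  refine ⟨fun i => (R * (2 * (d i).1.1 + (d i).2), R * (2 * (d i).1.2 + (d i).2)), ?_, ?_⟩
  · intro i hi
    have h := hd i hi
    simp only [S, box, Finset.mem_product, Finset.mem_sdiff, Finset.mem_Icc] at h
    simp only [abs_mul, Nat.abs_cast]
    rw [← mul_max_of_nonneg _ _ (by positivity)]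
    generalize d i = u at *
    constructor <;> refine mul_le_mul_of_nonneg_left ?_ (by positivity)
    · rw [le_max_iff, le_abs, le_abs]
      omega
    · rw [max_le_iff, abs_le, abs_le]
      omega
  · intro i hi j hj hij
    rw [Finset.disjoint_left]
    intro p hp hq
    rw [mem_l1Ball, Nat.cast_sub hR, Nat.cast_one] at hp hq
    beta_reduce at hp hq
    have h1 := hd i hi
    have h2 := hd j hj
    have hne : d i ≠ d j := fun h => hij (hinj i hi j hj h)
    generalize d i = u at *
    generalize d j = w at *
    simp only [S, Finset.mem_product, Finset.mem_Icc] at h1 h2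
    have hsep : 2 ≤ |(2 * u.1.1 + u.2) - (2 * w.1.1 + w.2)| +
        |(2 * u.1.2 + u.2) - (2 * w.1.2 + w.2)| := by
      by_contra! hlt
      have := eq_of_checkerboard_dist_lt h1.2 h2.2 hlt
      exact hne (Prod.ext (Prod.ext this.1 this.2.1) this.2.2)
    have hdist : (R : ℤ) * (|(2 * u.1.1 + u.2) - (2 * w.1.1 + w.2)| +
        |(2 * u.1.2 + u.2) - (2 * w.1.2 + w.2)|) ≤ 2 * (R - 1) := by
      have e1 : ∀ x y : ℤ, (R : ℤ) * |x - y| = |R * x - R * y| := by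
        intro x y
        rw [← mul_sub, abs_mul, Nat.abs_cast]
      rw [mul_add, e1, e1]
      have e2 : ∀ x y z : ℤ, |x - y| ≤ |z - x| + |z - y| := by
        intro x y z
        rw [abs_sub_comm z x]
        exact abs_sub_le x z y
      have h3 := e2 (R * (2 * u.1.1 + u.2)) (R * (2 * w.1.1 + w.2)) p.1
      have h4 := e2 (R * (2 * u.1.2 + u.2)) (R * (2 * w.1.2 + w.2)) p.2
      linarith
    have := mul_le_mul_of_nonneg_left hsep (show (0 : ℤ) ≤ R by positivity)
    linarith

/-- The common radius (plus one) of the balls activated in the times `[k⁴, (k+1)⁴)`. -/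
noncomputable def blockRadius (a : ℝ) (k : ℕ) : ℕ := ⌊√6 * a * k ^ 5 / (k + 10)⌋₊

theorem blockRadius_le {a : ℝ} (ha : 0 < a) (k : ℕ) :
    (blockRadius a k : ℝ) ≤ √6 * a * k ^ 5 / (k + 10) :=
  Nat.floor_le (by positivity)

theorem tendsto_blockRadius_div {a : ℝ} :
    Tendsto (fun k : ℕ => (√6 * a * k ^ 5 / (k + 10) - 2) / ((k : ℝ) + 1) ^ 4) atTop
      (nhds (√6 * a)) := by
  have h : ContinuousAt
      (fun x : ℝ => √6 * a / ((1 + 10 * x) * (1 + x) ^ 4) - 2 * x ^ 4 / (1 + x) ^ 4) 0 := by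
    refine ContinuousAt.sub (ContinuousAt.div (by fun_prop) (by fun_prop) (by norm_num))
      (ContinuousAt.div (by fun_prop) (by fun_prop) (by norm_num))
  have h' := h.tendsto.comp (tendsto_inv_atTop_nhds_zero_nat (𝕜 := ℝ))
  norm_num at h'
  refine h'.congr' ?_
  filter_upwards [eventually_gt_atTop 0] with k hk
  have : (0 : ℝ) < k := by exact_mod_cast hk
  simp only [Function.comp]
  field_simp

theorem eventually_one_le_blockRadius {a : ℝ} (ha : 0 < a) :
    ∀ᶠ k in atTop, 1 ≤ blockRadius a k := by
  have h := (tendsto_blockRadius_div (a := a)).eventually (lt_mem_nhds (show 0 < √6 * a by positivity))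
  filter_upwards [h] with k hk
  rw [blockRadius, Nat.one_le_floor_iff]
  have := (div_pos_iff_of_pos_right (by positivity)).1 hk
  linarith

theorem block_count {a R k : ℝ} (ha : 0 < a) (hk : 20 ≤ k) (hR : 1 ≤ R)
    (hRk : R ≤ √6 * a * k ^ 5 / (k + 10)) :
    ((k + 1) ^ 4 - k ^ 4) ≤
      8 * ((a * k ^ 6 - a * (k - 1) ^ 6) / (2 * R) - 3) *
        ((a * k ^ 6 + a * (k - 1) ^ 6) / (2 * R) - 1) ∧
      0 ≤ (a * k ^ 6 - a * (k - 1) ^ 6) / (2 * R) - 3 ∧ 0 ≤ (a * k ^ 6 + a * (k - 1) ^ 6) / (2 * R) - 1 := by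
  have h6 : √6 ≤ 5 / 2 := by rw [Real.sqrt_le_left (by norm_num)]; norm_num
  have hk0 : 0 < k := by linarith
  have hRa : R ≤ 5 / 2 * a * k ^ 4 := by
    refine hRk.trans ?_
    rw [div_le_iff₀ (by positivity)]
    have : √6 * a * k ^ 5 ≤ 5 / 2 * a * k ^ 5 := by gcongr
    refine this.trans ?_
    have : 0 < a * k ^ 4 := by positivity
    nlinarith
  have hR2 : R ^ 2 * (k + 10) ^ 2 ≤ 6 * a ^ 2 * k ^ 10 := by
    rw [le_div_iff₀ (by positivity)] at hRk
    have := pow_le_pow_left₀ (by positivity) hRk 2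
    have h66 : √6 ^ 2 = 6 := Real.sq_sqrt (by norm_num)
    calc R ^ 2 * (k + 10) ^ 2 = (R * (k + 10)) ^ 2 := by ring
      _ ≤ _ := this
      _ = √6 ^ 2 * a ^ 2 * k ^ 10 := by ring
      _ = _ := by rw [h66]
  have hX : 6 * a * k ^ 4 * (k - 5) ≤ a * k ^ 6 - a * (k - 1) ^ 6 - 6 * R := by
    have : 6 * k ^ 5 - 15 * k ^ 4 ≤ k ^ 6 - (k - 1) ^ 6 := by
      have : 0 ≤ 5 * k ^ 2 * (4 * k - 3) + (6 * k - 1) := by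
        have : 0 ≤ 4 * k - 3 := by linarith
        have : 0 ≤ 6 * k - 1 := by linarith
        positivity
      linarith
    have := mul_le_mul_of_nonneg_left this ha.le
    linarith
  have hY : 2 * a * k ^ 5 * (k - 3) ≤ a * k ^ 6 + a * (k - 1) ^ 6 - 2 * R := by
    have : 2 * k ^ 6 - 6 * k ^ 5 + 5 * k ^ 4 ≤ k ^ 6 + (k - 1) ^ 6 := by
      have : 0 ≤ 10 * k ^ 3 * (k - 2) + 3 * k * (5 * k - 2) + 1 := by
        have : 0 ≤ k - 2 := by linarith
        have : 0 ≤ 5 * k - 2 := by linarith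
        positivity
      linarith
    have := mul_le_mul_of_nonneg_left this ha.le
    linarith
  have hk5 : 0 ≤ k - 5 := by linarith
  have hk3 : 0 ≤ k - 3 := by linarith
  have hX0 : 0 ≤ 6 * a * k ^ 4 * (k - 5) := by positivity
  have hY0 : 0 ≤ 2 * a * k ^ 5 * (k - 3) := by positivity
  have eX : (a * k ^ 6 - a * (k - 1) ^ 6) / (2 * R) - 3 =
      (a * k ^ 6 - a * (k - 1) ^ 6 - 6 * R) / (2 * R) := by field_simp; ring
  have eY : (a * k ^ 6 + a * (k - 1) ^ 6) / (2 * R) - 1 =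
      (a * k ^ 6 + a * (k - 1) ^ 6 - 2 * R) / (2 * R) := by field_simp
  rw [eX, eY]
  refine ⟨?_, div_nonneg (hX0.trans hX) (by positivity), div_nonneg (hY0.trans hY) (by positivity)⟩
  have hpoly : k * ((k + 1) ^ 4 - k ^ 4) ≤ 4 * (k - 5) * (k - 3) * (k + 10) ^ 2 := by
    nlinarith [mul_nonneg (sq_nonneg k) (sub_nonneg.2 hk), mul_nonneg hk0.le (sub_nonneg.2 hk)]
  have hprod := mul_le_mul hX hY hY0 (hX0.trans hX)
  have hmain : R ^ 2 * ((k + 1) ^ 4 - k ^ 4) ≤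
      2 * (6 * a * k ^ 4 * (k - 5) * (2 * a * k ^ 5 * (k - 3))) := by
    have hd : 0 ≤ (k + 1) ^ 4 - k ^ 4 := by
      have : 0 ≤ 4 * k ^ 3 + 6 * k ^ 2 + 4 * k + 1 := by positivity
      linarith
    refine le_of_mul_le_mul_right ?_ (show 0 < (k + 10) ^ 2 by positivity)
    calc R ^ 2 * ((k + 1) ^ 4 - k ^ 4) * (k + 10) ^ 2
        = (R ^ 2 * (k + 10) ^ 2) * ((k + 1) ^ 4 - k ^ 4) := by ring
      _ ≤ 6 * a ^ 2 * k ^ 10 * ((k + 1) ^ 4 - k ^ 4) := by gcongr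
      _ = 6 * a ^ 2 * k ^ 9 * (k * ((k + 1) ^ 4 - k ^ 4)) := by ring
      _ ≤ 6 * a ^ 2 * k ^ 9 * (4 * (k - 5) * (k - 3) * (k + 10) ^ 2) := by gcongr
      _ = _ := by ring
  rw [mul_assoc, div_mul_div_comm, ← mul_div_assoc, le_div_iff₀ (by positivity)]
  linarith

theorem exists_block {a : ℝ} (ha : 0 < a) :
    ∀ᶠ k : ℕ in atTop, ∃ c : ℕ → ℤ × ℤ,
      (∀ i < (k + 1) ^ 4 - k ^ 4,
        a * ((k : ℝ) - 1) ^ 6 + blockRadius a k ≤ ((max |(c i).1| |(c i).2| : ℤ) : ℝ) ∧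
        ((max |(c i).1| |(c i).2| : ℤ) : ℝ) ≤ a * (k : ℝ) ^ 6 - blockRadius a k) ∧
      ∀ i < (k + 1) ^ 4 - k ^ 4, ∀ j < (k + 1) ^ 4 - k ^ 4, i ≠ j →
        Disjoint (l1Ball (c i) (blockRadius a k - 1)) (l1Ball (c j) (blockRadius a k - 1)) := by
  filter_upwards [eventually_one_le_blockRadius ha, eventually_ge_atTop 20] with k hR hk
  have hk' : (20 : ℝ) ≤ k := by exact_mod_cast hk
  have hR' : (1 : ℝ) ≤ blockRadius a k := by exact_mod_cast hR
  obtain ⟨hcount, hX, hY⟩ := block_count ha hk' hR' (blockRadius_le ha k)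
  set R := blockRadius a k
  have hR0 : (0 : ℝ) < R := by linarith
  have hL : 0 ≤ a * ((k : ℝ) - 1) ^ 6 := by positivity
  obtain ⟨P, hP⟩ : ∃ P : ℕ, P + 1 = ⌊a * (k : ℝ) ^ 6 / (2 * R)⌋₊ := by
    refine ⟨_, Nat.sub_add_cancel ?_⟩
    rw [Nat.one_le_floor_iff]
    have hX := hX
    rw [sub_div] at hX
    have := div_nonneg hL (show (0 : ℝ) ≤ 2 * R by positivity)
    linarith
  set Q := ⌈a * ((k : ℝ) - 1) ^ 6 / (2 * R)⌉₊
  have hP1 : (P : ℝ) + 1 ≤ a * (k : ℝ) ^ 6 / (2 * R) := by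
    have := Nat.floor_le (show 0 ≤ a * (k : ℝ) ^ 6 / (2 * R) by positivity)
    rw [← hP] at this
    exact_mod_cast this
  have hP2 : a * (k : ℝ) ^ 6 / (2 * R) < P + 2 := by
    have := Nat.lt_floor_add_one (a * (k : ℝ) ^ 6 / (2 * R))
    rw [← hP] at this
    push_cast at this
    linarith
  have hQ1 : a * ((k : ℝ) - 1) ^ 6 / (2 * R) ≤ Q := Nat.le_ceil _
  have hQ2 : (Q : ℝ) < a * ((k : ℝ) - 1) ^ 6 / (2 * R) + 1 := Nat.ceil_lt_add_one (by positivity)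
  have hN : (k + 1) ^ 4 - k ^ 4 + 2 * (2 * Q + 1) ^ 2 ≤ 2 * (2 * P + 1) ^ 2 := by
    have hpow : k ^ 4 ≤ (k + 1) ^ 4 := by gcongr; omega
    have : ((k : ℝ) + 1) ^ 4 - k ^ 4 ≤ 8 * ((P : ℝ) - Q) * (P + Q + 1) := by
      refine hcount.trans ?_
      rw [sub_div] at hX
      rw [add_div] at hY
      rw [sub_div, add_div]
      refine mul_le_mul ?_ ?_ hY ?_ <;> linarith
    have h2 : (((k + 1) ^ 4 - k ^ 4 + 2 * (2 * Q + 1) ^ 2 : ℕ) : ℝ) ≤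
        (2 * (2 * P + 1) ^ 2 : ℕ) := by
      push_cast [hpow]
      linarith
    exact_mod_cast h2
  obtain ⟨c, hc1, hc2⟩ := exists_disjoint_l1Balls hR hN
  refine ⟨c, fun i hi => ⟨?_, ?_⟩, hc2⟩
  · have h1 : ((R * (2 * Q + 1) : ℤ) : ℝ) ≤ ((max |(c i).1| |(c i).2| : ℤ) : ℝ) :=
      Int.cast_le.2 (hc1 i hi).1
    refine le_trans ?_ h1
    rw [div_le_iff₀ (by positivity)] at hQ1
    push_cast
    linarith
  · have h1 : ((max |(c i).1| |(c i).2| : ℤ) : ℝ) ≤ ((R * (2 * P + 1) : ℤ) : ℝ) :=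
      Int.cast_le.2 (hc1 i hi).2
    refine h1.trans ?_
    rw [le_div_iff₀ (by positivity)] at hP1
    push_cast
    linarith

theorem abs_max_sub_le_of_mem_l1Ball {v p : ℤ × ℤ} {r : ℕ} (h : p ∈ l1Ball v r) :
    max |p.1| |p.2| ≤ max |v.1| |v.2| + r ∧ max |v.1| |v.2| ≤ max |p.1| |p.2| + r := by
  rw [mem_l1Ball] at h
  have h1 := abs_nonneg (p.1 - v.1)
  have h2 := abs_nonneg (p.2 - v.2)
  have h3 := abs_le.1 (abs_abs_sub_abs_le p.1 v.1)
  have h4 := abs_le.1 (abs_abs_sub_abs_le p.2 v.2)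
  omega

/-- The index `k` of the block `[k⁴, (k+1)⁴)` containing `t`. -/
def blockIndex (t : ℕ) : ℕ := Nat.sqrt (Nat.sqrt t)

theorem blockIndex_pow_le (t : ℕ) : blockIndex t ^ 4 ≤ t := by
  have h1 := Nat.sqrt_le' t
  have h2 := Nat.sqrt_le' (Nat.sqrt t)
  calc blockIndex t ^ 4 = (blockIndex t ^ 2) ^ 2 := by ring
    _ ≤ (Nat.sqrt t) ^ 2 := by gcongr; exact h2
    _ ≤ t := h1

theorem lt_blockIndex_succ_pow (t : ℕ) : t < (blockIndex t + 1) ^ 4 := by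
  have h1 := Nat.lt_succ_sqrt' t
  have h2 := Nat.lt_succ_sqrt' (Nat.sqrt t)
  calc t < (Nat.sqrt t + 1) ^ 2 := h1
    _ ≤ ((blockIndex t + 1) ^ 2) ^ 2 := by gcongr; exact h2
    _ = _ := by ring

theorem tendsto_blockIndex : Tendsto blockIndex atTop atTop := by
  refine tendsto_atTop_mono (f := fun t => Nat.sqrt (Nat.sqrt t)) (fun _ => le_rfl) ?_
  have h : Tendsto Nat.sqrt atTop atTop := by
    refine tendsto_atTop.2 fun b => ?_
    filter_upwards [eventually_ge_atTop (b * b)] with t ht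
    exact Nat.le_sqrt.2 ht
  exact h.comp h

/-- An asymptotically perfect packing: a ball of radius `r t ≈ √6 a t` for each time `t`, all
disjoint, whose centre lies in the square `[-a t^(3/2), a t^(3/2)]²`. -/
theorem exists_packing {a : ℝ} (ha : 0 < a) :
    ∃ (v : ℕ → ℤ × ℤ) (r : ℕ → ℕ) (N : ℕ),
      (∀ t, N ≤ t → ((max |(v t).1| |(v t).2| : ℤ) : ℝ) ≤ a * (t : ℝ) ^ ((3 : ℝ) / 2)) ∧
      (∀ s, N ≤ s → ∀ t, N ≤ t → s ≠ t → Disjoint (l1Ball (v s) (r s)) (l1Ball (v t) (r t))) ∧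
      ∀ b < √6 * a, ∀ᶠ t : ℕ in atTop, b * t ≤ r t := by
  obtain ⟨K, hK⟩ := eventually_atTop.1
    ((exists_block ha).and ((eventually_one_le_blockRadius ha).and (eventually_ge_atTop 1)))
  choose! c hc1 hc2 using fun k hk => (hK k hk).1
  have hmem : ∀ t, t - blockIndex t ^ 4 < (blockIndex t + 1) ^ 4 - blockIndex t ^ 4 := fun t =>
    Nat.sub_lt_sub_right (blockIndex_pow_le t) (lt_blockIndex_succ_pow t)
  obtain ⟨N, hN⟩ := eventually_atTop.1 (tendsto_blockIndex.eventually_ge_atTop K)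
  have hlt : ∀ s, N ≤ s → ∀ t, N ≤ t → blockIndex s < blockIndex t →
      Disjoint (l1Ball (c (blockIndex s) (s - blockIndex s ^ 4)) (blockRadius a (blockIndex s) - 1))
        (l1Ball (c (blockIndex t) (t - blockIndex t ^ 4)) (blockRadius a (blockIndex t) - 1)) := by
    intro s hs t ht hst
    rw [Finset.disjoint_left]
    intro p hp hq
    have h1 := (hc1 _ (hN s hs) _ (hmem s)).2
    have h2 := (hc1 _ (hN t ht) _ (hmem t)).1
    have h3 := (abs_max_sub_le_of_mem_l1Ball hp).1
    have h4 := (abs_max_sub_le_of_mem_l1Ball hq).2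
    have h3' := (Int.cast_le (R := ℝ)).2 h3
    have h4' := (Int.cast_le (R := ℝ)).2 h4
    rw [Nat.cast_sub (hK _ (hN s hs)).2.1] at h3'
    rw [Nat.cast_sub (hK _ (hN t ht)).2.1] at h4'
    have hpow : a * (blockIndex s : ℝ) ^ 6 ≤ a * ((blockIndex t : ℝ) - 1) ^ 6 := by
      have : (blockIndex s : ℝ) + 1 ≤ blockIndex t := by exact_mod_cast hst
      gcongr
      linarith
    rw [Int.cast_add] at h3' h4'
    simp only [Int.cast_sub, Int.cast_natCast, Nat.cast_one, Int.cast_one] at h3' h4'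
    linarith
  refine ⟨fun t => c (blockIndex t) (t - blockIndex t ^ 4),
    fun t => blockRadius a (blockIndex t) - 1, N, ?_, ?_, ?_⟩
  · intro t ht
    have h1 := (hc1 _ (hN t ht) _ (hmem t)).2
    have h2 : (blockIndex t : ℝ) ^ 6 ≤ (t : ℝ) ^ ((3 : ℝ) / 2) := by
      have h3 : ((blockIndex t : ℝ) ^ 4) ≤ t := by exact_mod_cast blockIndex_pow_le t
      calc (blockIndex t : ℝ) ^ 6 = ((blockIndex t : ℝ) ^ 4) ^ ((3 : ℝ) / 2) := by
            rw [← Real.rpow_natCast, ← Real.rpow_natCast, ← Real.rpow_mul (by positivity)]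
            norm_num
        _ ≤ _ := by gcongr
    have h3 := mul_le_mul_of_nonneg_left h2 ha.le
    have h4 : (0 : ℝ) ≤ blockRadius a (blockIndex t) := by positivity
    linarith
  · intro s hs t ht hst
    rcases lt_trichotomy (blockIndex s) (blockIndex t) with h | h | h
    · exact hlt s hs t ht h
    · have h1 := hmem s
      have h2 := hmem t
      have h3 := blockIndex_pow_le s
      have h4 := blockIndex_pow_le t
      have := hc2 _ (hN t ht)
      beta_reduce
      rw [h] at *
      exact this _ h1 _ h2 (by omega)
    · exact (hlt t ht s hs h).symm
  · intro b hb
    have h := (tendsto_blockRadius_div (a := a)).eventually (lt_mem_nhds hb)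
    filter_upwards [tendsto_blockIndex.eventually h, eventually_ge_atTop N] with t h1 ht
    have hR := (hK _ (hN t ht)).2.1
    rcases le_or_gt b 0 with hb0 | hb0
    · exact (mul_nonpos_of_nonpos_of_nonneg hb0 (by positivity)).trans (by positivity)
    · rw [lt_div_iff₀ (by positivity)] at h1
      have h2 : (t : ℝ) ≤ ((blockIndex t : ℝ) + 1) ^ 4 := by
        exact_mod_cast (lt_blockIndex_succ_pow t).le
      have h3 := mul_le_mul_of_nonneg_left h2 hb0.le
      have h4 := Nat.lt_floor_add_one (√6 * a * (blockIndex t : ℝ) ^ 5 / (blockIndex t + 10))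
      rw [Nat.cast_sub hR, blockRadius]
      push_cast
      linarith

theorem le_sum_range_sq (m : ℕ) :
    (m : ℝ) ^ 3 / 3 - (m : ℝ) ^ 2 / 2 ≤ ∑ j ∈ Finset.range m, (j : ℝ) ^ 2 := by
  induction m with
  | zero => simp
  | succ m ih =>
    rw [Finset.sum_range_succ]
    push_cast
    linarith

theorem le_sum_min_sq {b : ℝ} (hb : 0 ≤ b) {M n : ℕ} (hMn : M ≤ n) :
    2 * b ^ 2 * ((n / (1 + b)) ^ 3 / 3 - ((n : ℝ) + 1) ^ 2 / 2 - (M : ℝ) ^ 3) +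
        2 * ((n * (1 - 1 / (1 + b))) ^ 3 / 3 - (n : ℝ) ^ 2 / 2) ≤
      ∑ t ∈ Finset.Ico M (n + 1), 2 * min ((n : ℝ) - t) (b * t) ^ 2 := by
  set g : ℕ → ℝ := fun t => 2 * min ((n : ℝ) - t) (b * t) ^ 2
  set m := ⌊(n : ℝ) / (1 + b)⌋₊
  have hdiv : (n : ℝ) / (1 + b) ≤ n := div_le_self (by positivity) (by linarith)
  have hm1 : (m : ℝ) ≤ n / (1 + b) := Nat.floor_le (by positivity)
  have hm2 : (n : ℝ) / (1 + b) < m + 1 := Nat.lt_floor_add_one _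
  have hmn : m ≤ n := by exact_mod_cast hm1.trans hdiv
  have hsplit : ∑ t ∈ Finset.Ico M (n + 1), g t =
      ∑ t ∈ Finset.range (m + 1), g t + ∑ t ∈ Finset.Ico (m + 1) (n + 1), g t -
        ∑ t ∈ Finset.range M, g t := by
    rw [Finset.sum_range_add_sum_Ico _ (by omega), Finset.sum_Ico_eq_sub _ (by omega)]
  have hearly : ∑ t ∈ Finset.range (m + 1), g t =
      2 * b ^ 2 * ∑ t ∈ Finset.range (m + 1), (t : ℝ) ^ 2 := by
    rw [Finset.mul_sum]
    refine Finset.sum_congr rfl fun t ht => ?_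
    have h1 : (t : ℝ) ≤ m := by exact_mod_cast Nat.lt_succ_iff.1 (Finset.mem_range.1 ht)
    have h2 := h1.trans hm1
    rw [le_div_iff₀ (by positivity)] at h2
    simp only [g]
    rw [min_eq_right (by linarith)]
    ring
  have hlate : ∑ t ∈ Finset.Ico (m + 1) (n + 1), g t =
      2 * ∑ j ∈ Finset.range (n - m), (j : ℝ) ^ 2 := by
    rw [Finset.mul_sum]
    refine Finset.sum_nbij' (fun s => n - s) (fun j => n - j) ?_ ?_ ?_ ?_ ?_
    iterate 4 simp only [Finset.mem_Ico, Finset.mem_range]; intros; omega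
    intro t ht
    rw [Finset.mem_Ico] at ht
    have h1 : (m : ℝ) + 1 ≤ t := by exact_mod_cast ht.1
    have h2 := hm2.trans_le h1
    rw [div_lt_iff₀ (by positivity)] at h2
    simp only [g]
    rw [min_eq_left (by linarith), Nat.cast_sub (by omega)]
  have hinit : ∑ t ∈ Finset.range M, g t ≤ 2 * b ^ 2 * (M : ℝ) ^ 3 := by
    have : ∀ t ∈ Finset.range M, g t ≤ 2 * b ^ 2 * (M : ℝ) ^ 2 := by
      intro t ht
      have ht' : (t : ℝ) ≤ M := by exact_mod_cast (Finset.mem_range.1 ht).le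
      have htn : (t : ℝ) ≤ n := ht'.trans (by exact_mod_cast hMn)
      have h0 : 0 ≤ min ((n : ℝ) - t) (b * t) := le_min (by linarith) (by positivity)
      calc g t ≤ 2 * (b * M) ^ 2 := by
            simp only [g]
            gcongr
            exact (min_le_right _ _).trans (by gcongr)
        _ = _ := by ring
    refine (Finset.sum_le_card_nsmul _ _ _ this).trans_eq ?_
    rw [Finset.card_range, nsmul_eq_mul]
    ring
  have h1 := le_sum_range_sq (m + 1)
  have h2 := le_sum_range_sq (n - m)
  push_cast [hmn] at h1 h2
  have hm3 : (m : ℝ) ≤ n := by exact_mod_cast hmn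
  have h3 : ((n : ℝ) / (1 + b)) ^ 3 ≤ ((m : ℝ) + 1) ^ 3 := by gcongr
  have h4 : ((m : ℝ) + 1) ^ 2 ≤ ((n : ℝ) + 1) ^ 2 := by gcongr
  have h5 : ((n : ℝ) * (1 - 1 / (1 + b))) ^ 3 ≤ ((n : ℝ) - m) ^ 3 := by
    have : 0 ≤ 1 - 1 / (1 + b) := by
      rw [sub_nonneg, div_le_one (by positivity)]
      linarith
    gcongr
    rw [mul_sub, mul_one_div]
    linarith
  have h6 : ((n : ℝ) - m) ^ 2 ≤ (n : ℝ) ^ 2 := by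
    have : 0 ≤ (n : ℝ) - m := by linarith
    gcongr
    linarith [Nat.cast_nonneg (α := ℝ) m]
  rw [hsplit, hearly, hlate]
  have h7 := mul_le_mul_of_nonneg_left
    (show (n / (1 + b)) ^ 3 / 3 - ((n : ℝ) + 1) ^ 2 / 2 ≤
      ∑ t ∈ Finset.range (m + 1), (t : ℝ) ^ 2 by linarith)
    (show 0 ≤ 2 * b ^ 2 by positivity)
  linarith

/-- Disjoint balls kept at radius at least `b t` give a lower bound on the number of burning
vertices. -/
theorem le_card_burnSet {f : ℕ → ℕ} {V : ℕ → Option (ℤ × ℤ)} {v : ℕ → ℤ × ℤ} {r : ℕ → ℕ}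
    {M n : ℕ} {b : ℝ} (hb : 0 ≤ b) (hM : 1 ≤ M) (hMn : M ≤ n)
    (hV : ∀ t, M ≤ t → V t = some (v t))
    (hgrid : ∀ t, M ≤ t → ∀ s, ∀ p ∈ l1Ball (v t) s, inGrid f (t + s) p)
    (hdisj : ∀ s, M ≤ s → ∀ t, M ≤ t → s ≠ t →
      Disjoint (l1Ball (v s) (r s)) (l1Ball (v t) (r t)))
    (hr : ∀ t, M ≤ t → b * t ≤ r t) :
    2 * b ^ 2 * ((n / (1 + b)) ^ 3 / 3 - ((n : ℝ) + 1) ^ 2 / 2 - (M : ℝ) ^ 3) +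
        2 * ((n * (1 - 1 / (1 + b))) ^ 3 / 3 - (n : ℝ) ^ 2 / 2) ≤
      ((burnSet f V n).card : ℝ) := by
  refine (le_sum_min_sq hb hMn).trans ?_
  have hsub : (Finset.Ico M (n + 1)).biUnion (fun t => l1Ball (v t) (min (n - t) (r t))) ⊆
      burnSet f V n := by
    refine Finset.biUnion_subset.2 fun t ht => ?_
    rw [Finset.mem_Ico] at ht
    have h := l1Ball_subset_burnSet (hM.trans ht.1) (hV t ht.1) (hgrid t ht.1) (n - t)
    rw [Nat.add_sub_cancel' (by omega)] at h
    exact (l1Ball_mono (min_le_left _ _)).trans h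
  have hcard := Finset.card_le_card hsub
  rw [Finset.card_biUnion] at hcard
  · refine le_trans ?_ (Nat.cast_le.2 hcard)
    push_cast
    refine Finset.sum_le_sum fun t ht => ?_
    rw [Finset.mem_Ico] at ht
    have htn : (t : ℝ) ≤ n := by exact_mod_cast Nat.lt_succ_iff.1 ht.2
    have h0 : 0 ≤ min ((n : ℝ) - t) (b * t) := le_min (by linarith) (by positivity)
    have h1 : min ((n : ℝ) - t) (b * t) ≤ ((min (n - t) (r t) : ℕ) : ℝ) := by
      rw [Nat.cast_min, Nat.cast_sub (by omega)]
      exact min_le_min le_rfl (hr t ht.1)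
    rw [card_l1Ball]
    have h2 := pow_le_pow_left₀ h0 h1 2
    have h3 := h0.trans h1
    simp only [Nat.cast_add, Nat.cast_mul, Nat.cast_pow, Nat.cast_ofNat, Nat.cast_one]
    linarith
  · intro s hs t ht hst
    simp only [Finset.coe_Ico, Set.mem_Ico] at hs ht
    exact (hdisj s hs.1 t ht.1 hst).mono (l1Ball_mono (min_le_right _ _))
      (l1Ball_mono (min_le_right _ _))

theorem rpow_three_halves {x : ℝ} (hx : 0 ≤ x) : x ^ ((3 : ℝ) / 2) = √x ^ 3 := by
  rw [Real.sqrt_eq_rpow, ← Real.rpow_natCast, ← Real.rpow_mul hx]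
  norm_num

theorem tendsto_inv_sqrt_natCast : Tendsto (fun n : ℕ => (√(n : ℝ))⁻¹) atTop (nhds 0) :=
  tendsto_inv_atTop_zero.comp (Real.tendsto_sqrt_atTop.comp tendsto_natCast_atTop_atTop)

/-- The optimal value of the upper bound in `card_burnSet_le`, over all choices of `t ∼ n / κ`, is
attained at `κ = 1 + √6 a`. -/
theorem eventually_card_burnSet_le {a : ℝ} (ha : 0 ≤ a) {f : ℕ → ℕ} {V : ℕ → Option (ℤ × ℤ)}
    (hV : IsActivator (fun n => ⌈a * (n : ℝ) ^ ((3 : ℝ) / 2)⌉₊) V) {u : ℝ}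
    (hu : 4 * (a / (1 + √6 * a)) ^ 2 < u) :
    ∀ᶠ n : ℕ in atTop, ((burnSet f V n).card : ℝ) / (n : ℝ) ^ 3 ≤ u := by
  set κ : ℝ := 1 + √6 * a with hκ
  have hκ1 : 1 ≤ κ := by rw [hκ]; linarith [mul_nonneg (Real.sqrt_nonneg 6) ha]
  have hκ0 : 0 < κ := by linarith
  set F : ℕ → ℕ := fun n => ⌈a * (n : ℝ) ^ ((3 : ℝ) / 2)⌉₊
  have hF : Monotone F := fun m n h => by
    simp only [F]
    gcongr
  let g : ℝ → ℝ := fun x => (2 * (a * √(1 / κ) ^ 3 + x ^ 3 + x) + x ^ 3) ^ 2 +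
    (2 * (1 - 1 / κ + x ^ 2) ^ 3 + (1 - 1 / κ + x ^ 2) * x ^ 4) / 3
  have hg : Tendsto (fun n : ℕ => g (√(n : ℝ))⁻¹) atTop (nhds (4 * (a / κ) ^ 2)) := by
    have hcont : Continuous g := by fun_prop
    have h := (hcont.tendsto 0).comp tendsto_inv_sqrt_natCast
    have h0 : g 0 = 4 * (a / κ) ^ 2 := by
      have h1 : 1 - 1 / κ = √6 * a / κ := by
        rw [hκ]
        field_simp
        ring
      have h2 : (√(1 / κ) ^ 3) ^ 2 = (1 / κ) ^ 3 := by
        rw [← pow_mul, mul_comm 3 2, pow_mul, Real.sq_sqrt (by positivity)]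
      have h3 : √6 ^ 3 = 6 * √6 := by rw [pow_succ, Real.sq_sqrt (by norm_num)]
      calc g 0 = 4 * a ^ 2 * (√(1 / κ) ^ 3) ^ 2 + 2 / 3 * (1 - 1 / κ) ^ 3 := by simp [g]; ring
        _ = 4 * a ^ 2 * (1 / κ) ^ 3 + 2 / 3 * (√6 ^ 3 * a ^ 3 / κ ^ 3) := by rw [h2, h1]; ring_nf
        _ = 4 * (a ^ 2 * (1 + √6 * a) / κ ^ 3) := by rw [h3]; ring_nf
        _ = 4 * (a / κ) ^ 2 := by rw [← hκ]; field_simp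
    rwa [h0] at h
  filter_upwards [hg.eventually (gt_mem_nhds hu), eventually_gt_atTop 0] with n hn hn0
  refine le_trans ?_ hn.le
  have hn' : (0 : ℝ) < n := by exact_mod_cast hn0
  set t := ⌊(n : ℝ) / κ⌋₊
  have ht1 : (t : ℝ) ≤ n / κ := Nat.floor_le (by positivity)
  have ht2 : (n : ℝ) / κ < t + 1 := Nat.lt_floor_add_one _
  have htn : t ≤ n := by exact_mod_cast ht1.trans (div_le_self hn'.le hκ1)
  have hcard := card_burnSet_le (f := f) hF hV htn
  have hs : 0 < √(n : ℝ) := Real.sqrt_pos.2 hn'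
  have hs2 : √(n : ℝ) ^ 2 = n := Real.sq_sqrt hn'.le
  have hFt : (F t : ℝ) ≤ a * √(1 / κ) ^ 3 * √(n : ℝ) ^ 3 + 1 := by
    refine (Nat.ceil_lt_add_one (by positivity)).le.trans ?_
    have : (t : ℝ) ^ ((3 : ℝ) / 2) ≤ √(1 / κ) ^ 3 * √(n : ℝ) ^ 3 := by
      rw [rpow_three_halves (by positivity), ← mul_pow, ← Real.sqrt_mul (by positivity)]
      gcongr
      rwa [one_div_mul_eq_div]
    rw [mul_assoc]
    gcongr
  have hnt : (n : ℝ) - t ≤ n * (1 - 1 / κ) + 1 := by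
    rw [mul_sub, mul_one_div]
    linarith
  have hnt0 : 0 ≤ (n : ℝ) - t := sub_nonneg.2 (by exact_mod_cast htn)
  rw [div_le_iff₀ (by positivity)]
  calc ((burnSet f V n).card : ℝ)
      ≤ (2 * ((F t : ℝ) + n) + 1) ^ 2 + (2 * ((n : ℝ) - t) ^ 3 + (n - t)) / 3 := hcard
    _ ≤ (2 * (a * √(1 / κ) ^ 3 * √(n : ℝ) ^ 3 + 1 + n) + 1) ^ 2 +
        (2 * (n * (1 - 1 / κ) + 1) ^ 3 + (n * (1 - 1 / κ) + 1)) / 3 := by gcongr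
    _ = g (√(n : ℝ))⁻¹ * (n : ℝ) ^ 3 := by
        simp only [g]
        generalize √(n : ℝ) = s at hs hs2 ⊢
        rw [← hs2]
        generalize √(1 / κ) = w
        field_simp

theorem tendsto_grid {c : ℝ} (hc : 0 < c) :
    Tendsto (fun n : ℕ => (2 * (⌈c * (n : ℝ) ^ ((3 : ℝ) / 2)⌉₊ : ℝ) + 1) ^ 2 / (n : ℝ) ^ 3) atTop
      (nhds (4 * c ^ 2)) := by
  have hX : Tendsto (fun n : ℕ => (n : ℝ) ^ ((3 : ℝ) / 2)) atTop atTop :=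
    (tendsto_rpow_atTop (by norm_num)).comp tendsto_natCast_atTop_atTop
  have h1 := (tendsto_nat_ceil_mul_div_atTop hc.le).comp hX
  have h2 := tendsto_inv_atTop_zero.comp hX
  have h3 := ((h1.const_mul 2).add h2).pow 2
  rw [show (2 * c + 0) ^ 2 = 4 * c ^ 2 by ring] at h3
  refine h3.congr' ?_
  filter_upwards [eventually_gt_atTop 0] with n hn
  have hn' : (0 : ℝ) < n := by exact_mod_cast hn
  have hpow : (n : ℝ) ^ 3 = ((n : ℝ) ^ ((3 : ℝ) / 2)) ^ 2 := by
    rw [← Real.rpow_natCast, ← Real.rpow_natCast, ← Real.rpow_mul hn'.le]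
    norm_num
  have hX0 : 0 < (n : ℝ) ^ ((3 : ℝ) / 2) := by positivity
  rw [hpow]
  simp only [Function.comp]
  field_simp

theorem densitySeq_eq {f : ℕ → ℕ} {V : ℕ → Option (ℤ × ℤ)} {n : ℕ} (hn : 0 < n) :
    densitySeq f V n =
      ((burnSet f V n).card / (n : ℝ) ^ 3) / ((2 * (f n : ℝ) + 1) ^ 2 / (n : ℝ) ^ 3) := by
  have : (0 : ℝ) < n := by exact_mod_cast hn
  rw [densitySeq]
  field_simp

theorem inGrid_of_mem_l1Ball {a c : ℝ} (hac : a ≤ c) {f : ℕ → ℕ}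
    (hf : ∀ n, f n = ⌈c * (n : ℝ) ^ ((3 : ℝ) / 2)⌉₊) {t s : ℕ} {v p : ℤ × ℤ}
    (hv : ((max |v.1| |v.2| : ℤ) : ℝ) ≤ a * (t : ℝ) ^ ((3 : ℝ) / 2)) (hc : 0 < c)
    (ht : 1 ≤ c * √(t : ℝ)) (hp : p ∈ l1Ball v s) : inGrid f (t + s) p := by
  have h1 := (Int.cast_le (R := ℝ)).2 (abs_max_sub_le_of_mem_l1Ball hp).1
  rw [Int.cast_add, Int.cast_natCast] at h1
  have h2 : c * √(t : ℝ) ^ 3 + s ≤ c * √((t : ℝ) + s) ^ 3 := by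
    have hs1 : √(t : ℝ) ^ 2 = t := Real.sq_sqrt (by positivity)
    have hs2 : √((t : ℝ) + s) ^ 2 = t + s := Real.sq_sqrt (by positivity)
    have hle : √(t : ℝ) ≤ √((t : ℝ) + s) := Real.sqrt_le_sqrt (by simp)
    calc c * √(t : ℝ) ^ 3 + s ≤ c * √(t : ℝ) ^ 3 + (c * √(t : ℝ)) * s := by
          have := mul_le_mul_of_nonneg_right ht (Nat.cast_nonneg (α := ℝ) s)
          linarith
      _ = c * ((√(t : ℝ) ^ 2 + s) * √(t : ℝ)) := by ring
      _ = c * (√((t : ℝ) + s) ^ 2 * √(t : ℝ)) := by rw [hs1, hs2]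
      _ ≤ c * (√((t : ℝ) + s) ^ 2 * √((t : ℝ) + s)) := by gcongr
      _ = _ := by ring
  have h3 : ((max |p.1| |p.2| : ℤ) : ℝ) ≤ (f (t + s) : ℝ) := by
    rw [hf]
    refine le_trans ?_ (Nat.le_ceil _)
    rw [rpow_three_halves (by positivity)] at hv ⊢
    push_cast
    have : a * √(t : ℝ) ^ 3 ≤ c * √(t : ℝ) ^ 3 := by gcongr
    push_cast at h1 hv
    linarith
  have h4 : max |p.1| |p.2| ≤ (f (t + s) : ℤ) := by exact_mod_cast h3
  exact max_le_iff.1 h4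

/-- For `0 < a ≤ c` some activator sequence burns asymptotically `4 (a / (1 + √6 a))² n³`
vertices by time `n`. -/
theorem exists_activator_tendsto {a c : ℝ} (ha : 0 < a) (hac : a ≤ c) {f : ℕ → ℕ}
    (hf : ∀ n, f n = ⌈c * (n : ℝ) ^ ((3 : ℝ) / 2)⌉₊) :
    ∃ V : ℕ → Option (ℤ × ℤ), IsActivator f V ∧ (∃ t, 1 ≤ t ∧ V t ≠ none) ∧
      Tendsto (fun n : ℕ => ((burnSet f V n).card : ℝ) / (n : ℝ) ^ 3) atTop
        (nhds (4 * (a / (1 + √6 * a)) ^ 2)) := by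
  have hc : 0 < c := ha.trans_le hac
  obtain ⟨v, r, N, hv, hdisj, hr⟩ := exists_packing ha
  have hsqrt : ∀ᶠ t : ℕ in atTop, 1 ≤ c * √(t : ℝ) :=
    ((Real.tendsto_sqrt_atTop.comp tendsto_natCast_atTop_atTop).const_mul_atTop
      hc).eventually_ge_atTop 1
  obtain ⟨N', hN'⟩ := eventually_atTop.1
    (hsqrt.and ((eventually_ge_atTop N).and (eventually_ge_atTop 1)))
  let V : ℕ → Option (ℤ × ℤ) := fun t => if N' ≤ t then some (v t) else none
  have hVsome : ∀ t, N' ≤ t → V t = some (v t) := fun t ht => if_pos ht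
  have hVv : ∀ t p, V t = some p → N' ≤ t ∧ p = v t := by
    intro t p h
    simp only [V] at h
    split_ifs at h with ht
    exact ⟨ht, (Option.some.inj h).symm⟩
  have hgrid : ∀ t, N' ≤ t → ∀ s, ∀ p ∈ l1Ball (v t) s, inGrid f (t + s) p :=
    fun t ht s p hp => inGrid_of_mem_l1Ball hac hf (hv t (hN' t ht).2.1) hc (hN' t ht).1 hp
  refine ⟨V, ?_, ⟨N', (hN' N' le_rfl).2.2, by simp [hVsome N' le_rfl]⟩, ?_⟩
  · intro n _ p hp
    obtain ⟨h1, rfl⟩ := hVv n p hp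
    exact hgrid n h1 0 _ (by simp [mem_l1Ball])
  refine tendsto_order.2 ⟨fun u hu => ?_, fun u hu => ?_⟩
  · have hlim : Tendsto (fun b : ℝ => 2 / 3 * (b / (1 + b)) ^ 2) (nhdsWithin (√6 * a)
        (Set.Iio (√6 * a)))
        (nhds (4 * (a / (1 + √6 * a)) ^ 2)) := by
      have h : ContinuousAt (fun b : ℝ => 2 / 3 * (b / (1 + b)) ^ 2) (√6 * a) := by
        have : 1 + √6 * a ≠ 0 := by positivity
        fun_prop (disch := assumption)
      have h' := h.tendsto.mono_left (nhdsWithin_le_nhds (s := Set.Iio (√6 * a)))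
      convert h' using 2
      rw [div_pow, div_pow, mul_pow, Real.sq_sqrt (by norm_num)]
      ring
    have hpos : 0 < √6 * a := by positivity
    obtain ⟨b, hub, hb0, hb1⟩ := ((hlim.eventually (lt_mem_nhds hu)).and
      (Ioo_mem_nhdsLT hpos)).exists
    obtain ⟨M', hM'⟩ := eventually_atTop.1 ((hr b hb1).and (eventually_ge_atTop N'))
    set M := max M' N'
    have hM1 : 1 ≤ M := (hN' M (le_max_right _ _)).2.2
    have hlow : Tendsto (fun n : ℕ =>
        2 * b ^ 2 * ((1 / (1 + b)) ^ 3 / 3 - (1 + (n : ℝ)⁻¹) ^ 2 * (n : ℝ)⁻¹ / 2 -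
          (M : ℝ) ^ 3 * (n : ℝ)⁻¹ ^ 3) +
        2 * ((1 - 1 / (1 + b)) ^ 3 / 3 - (n : ℝ)⁻¹ / 2)) atTop
        (nhds (2 / 3 * (b / (1 + b)) ^ 2)) := by
      have hcont : Continuous (fun x : ℝ =>
          2 * b ^ 2 * ((1 / (1 + b)) ^ 3 / 3 - (1 + x) ^ 2 * x / 2 - (M : ℝ) ^ 3 * x ^ 3) +
          2 * ((1 - 1 / (1 + b)) ^ 3 / 3 - x / 2)) := by fun_prop
      have h := (hcont.tendsto 0).comp (tendsto_inv_atTop_nhds_zero_nat (𝕜 := ℝ))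
      have hval : 2 * b ^ 2 * ((1 / (1 + b)) ^ 3 / 3 - (1 + 0) ^ 2 * 0 / 2 - (M : ℝ) ^ 3 * 0 ^ 3) +
          2 * ((1 - 1 / (1 + b)) ^ 3 / 3 - 0 / 2) = 2 / 3 * (b / (1 + b)) ^ 2 := by
        have : 1 + b ≠ 0 := by positivity
        field_simp
        ring
      rw [← hval]
      exact h
    filter_upwards [hlow.eventually (lt_mem_nhds hub), eventually_ge_atTop M] with n hn hMn
    refine hn.trans_le ?_
    have hn0 : (0 : ℝ) < n := by exact_mod_cast hM1.trans hMn
    rw [le_div_iff₀ (by positivity)]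
    refine le_trans (le_of_eq ?_) (le_card_burnSet hb0.le hM1 hMn
      (fun t ht => hVsome t ((le_max_right _ _).trans ht))
      (fun t ht => hgrid t ((le_max_right _ _).trans ht))
      (fun s hs t ht => hdisj s (hN' s ((le_max_right _ _).trans hs)).2.1 t
        (hN' t ((le_max_right _ _).trans ht)).2.1)
      (fun t ht => (hM' t ((le_max_left _ _).trans ht)).1))
    field_simp
  · obtain ⟨w, hw1, hw2⟩ := exists_between hu
    have hact : IsActivator (fun n => ⌈a * (n : ℝ) ^ ((3 : ℝ) / 2)⌉₊) V := by
      intro n _ p hp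
      obtain ⟨h1, rfl⟩ := hVv n p hp
      have h2 := (hv n (hN' n h1).2.1).trans (Nat.le_ceil _)
      have h3 : max |(v n).1| |(v n).2| ≤ (⌈a * (n : ℝ) ^ ((3 : ℝ) / 2)⌉₊ : ℤ) := by
        exact_mod_cast h2
      exact max_le_iff.1 h3
    filter_upwards [eventually_card_burnSet_le (f := f) ha.le hact hw1] with n hn
    exact hn.trans_lt hw2

theorem exists_activator_tendsto_zero (f : ℕ → ℕ) :
    ∃ V : ℕ → Option (ℤ × ℤ), IsActivator f V ∧ (∃ t, 1 ≤ t ∧ V t ≠ none) ∧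
      Tendsto (fun n : ℕ => ((burnSet f V n).card : ℝ) / (n : ℝ) ^ 3) atTop (nhds 0) := by
  have hact : ∀ F, IsActivator F (fun _ => some 0) := by
    rintro F n - p hp
    obtain rfl := Option.some.inj hp
    simp [inGrid]
  refine ⟨fun _ => some 0, hact f, ⟨1, le_rfl, by simp⟩, ?_⟩
  refine tendsto_order.2 ⟨fun u hu => .of_forall fun n => hu.trans_le (by positivity),
    fun u hu => ?_⟩
  obtain ⟨w, hw1, hw2⟩ := exists_between hu
  filter_upwards [eventually_card_burnSet_le (f := f) le_rfl (hact _)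
    (show 4 * ((0 : ℝ) / (1 + √6 * 0)) ^ 2 < w by simpa using hw1)] with n hn
  exact hn.trans_lt hw2

/-- if `f(n) = ⌈c n^(3/2)⌉` with `c > 0`,
then `P(G(f)) = [0, (1 + √6 c)⁻²]`. -/
theorem burning_density_three_halves (c : ℝ) (hc : 0 < c) (f : ℕ → ℕ)
    (hf : ∀ n, f n = ⌈c * (n : ℝ) ^ ((3 : ℝ) / 2)⌉₊) :
    densSet f = Set.Icc 0 (((1 + Real.sqrt 6 * c) ^ 2)⁻¹) := by
  have hG : Tendsto (fun n : ℕ => (2 * (f n : ℝ) + 1) ^ 2 / (n : ℝ) ^ 3) atTop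
      (nhds (4 * c ^ 2)) := by simpa only [hf] using tendsto_grid hc
  have hκ : 0 < 1 + √6 * c := by positivity
  ext ρ
  constructor
  · rintro ⟨⟨h0, -⟩, V, hV, -, hρ⟩
    refine ⟨h0, ?_⟩
    obtain rfl : f = fun n : ℕ => ⌈c * (n : ℝ) ^ ((3 : ℝ) / 2)⌉₊ := funext hf
    have hlim := hρ.mul hG
    have hle : ρ * (4 * c ^ 2) ≤ 4 * (c / (1 + √6 * c)) ^ 2 := by
      refine le_of_forall_gt_imp_ge_of_dense fun u hu => le_of_tendsto hlim ?_
      filter_upwards [eventually_card_burnSet_le hc.le hV hu, eventually_gt_atTop 0] with n hn hn0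
      rw [densitySeq_eq hn0, div_mul_cancel₀ _ (by positivity)]
      exact hn
    rw [div_pow, div_eq_mul_inv] at hle
    refine le_of_mul_le_mul_right ?_ (show 0 < 4 * c ^ 2 by positivity)
    linarith
  · rintro ⟨h0, h1⟩
    have hsq : √ρ * (1 + √6 * c) ≤ 1 := by
      rw [← Real.sqrt_sq hκ.le, ← Real.sqrt_mul h0]
      refine Real.sqrt_le_iff.2 ⟨zero_le_one, ?_⟩
      rwa [one_pow, ← le_div_iff₀ (by positivity), one_div]
    have hρ1 : ρ ≤ 1 := h1.trans (inv_le_one_of_one_le₀ (one_le_pow₀ (by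
      have : 0 ≤ √6 * c := by positivity
      linarith)))
    refine ⟨⟨h0, hρ1⟩, ?_⟩
    suffices h : ∃ V : ℕ → Option (ℤ × ℤ), IsActivator f V ∧ (∃ t, 1 ≤ t ∧ V t ≠ none) ∧
        Tendsto (fun n : ℕ => ((burnSet f V n).card : ℝ) / (n : ℝ) ^ 3) atTop
          (nhds (4 * c ^ 2 * ρ)) by
      obtain ⟨V, hV, hne, hlim⟩ := h
      refine ⟨V, hV, hne, ?_⟩
      have h := hlim.div hG (by positivity)
      rw [mul_div_cancel_left₀ _ (by positivity)] at h
      refine Tendsto.congr' ?_ h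
      filter_upwards [eventually_gt_atTop 0] with n hn
      exact (densitySeq_eq hn).symm
    rcases h0.eq_or_lt with rfl | hpos
    · simpa using exists_activator_tendsto_zero f
    · have hs : 0 < √ρ := Real.sqrt_pos.2 hpos
      have hd : 0 < 1 - √6 * c * √ρ := by linarith
      have ha : 0 < c * √ρ / (1 - √6 * c * √ρ) := by positivity
      have hac : c * √ρ / (1 - √6 * c * √ρ) ≤ c := by
        rw [div_le_iff₀ hd]
        exact mul_le_mul_of_nonneg_left (by linarith) hc.le
      have h := exists_activator_tendsto ha hac hf
      have hval : c * √ρ / (1 - √6 * c * √ρ) / (1 + √6 * (c * √ρ / (1 - √6 * c * √ρ))) =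
          c * √ρ := by
        have : 1 + √6 * (c * √ρ / (1 - √6 * c * √ρ)) = 1 / (1 - √6 * c * √ρ) := by
          rw [eq_div_iff hd.ne', add_mul, mul_assoc √6 (_ / _), div_mul_cancel₀ _ hd.ne']
          ring
        rw [this, div_div_eq_mul_div, div_one, div_mul_cancel₀ _ hd.ne']
      rwa [hval, mul_pow, Real.sq_sqrt h0, ← mul_assoc] at h
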